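/- arXiv:1903.12000 — 2 statements merged into one kernel-verified Lean document; each statement's English description precedes it below -/
import Mathlib

section
/- Let A = (A_1,…,A_N) be an N-valued observable in ℂ^h and let B = (B_1,…,B_N) be an N-valued observable in ℂ^h that is unitarily equivalent to A, i.e. there exists a unitary U on ℂ^h with B_i = U A_i U* for all i. Then the direct sum A ⊕ B is extremal if and only if A is extremal. -/
open Matrix
open scoped ComplexOrder

/-- An `ι`-valued observable in `ℂ^n`: a family of positive semidefinite matrices
summing to the identity. -/
def IsObservable {ι n : Type*} [Fintype ι] [Fintype n] [DecidableEq n]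
    (A : ι → Matrix n n ℂ) : Prop :=
  (∀ i, (A i).PosSemidef) ∧ ∑ i, A i = 1

/-- An observable is extremal if it is an extreme point of the convex set of observables. -/
def IsExtremalObservable {ι n : Type*} [Fintype ι] [Fintype n] [DecidableEq n]
    (A : ι → Matrix n n ℂ) : Prop :=
  A ∈ Set.extremePoints ℝ {B : ι → Matrix n n ℂ | IsObservable B}

/-- The compression of an observable along an isometry is an observable. -/
theorem IsObservable.conjTranspose_mul_mul {ι m n : Type*} [Fintype ι] [Fintype m]
    [DecidableEq m] [Fintype n] [DecidableEq n] {X : ι → Matrix m m ℂ} (hX : IsObservable X)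
    {V : Matrix m n ℂ} (hV : Vᴴ * V = 1) : IsObservable (fun i => Vᴴ * X i * V) :=
  ⟨fun i => (hX.1 i).conjTranspose_mul_mul_same V, by
    simp only [← Matrix.sum_mul, ← Matrix.mul_sum, hX.2, Matrix.mul_one, hV]⟩

/-- If an isometry compresses `C` to an extremal observable `A`, then it also compresses to `A`
every endpoint of a segment of observables through `C`. -/
theorem IsExtremalObservable.conjTranspose_mul_mul_eq {ι m n : Type*} [Fintype ι] [Fintype m]
    [DecidableEq m] [Fintype n] [DecidableEq n] {A : ι → Matrix n n ℂ}
    (hA : IsExtremalObservable A) {C X Y : ι → Matrix m m ℂ} (hX : IsObservable X)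
    (hY : IsObservable Y) (hC : C ∈ openSegment ℝ X Y) {V : Matrix m n ℂ} (hV : Vᴴ * V = 1)
    (hVC : ∀ i, Vᴴ * C i * V = A i) (i : ι) : Vᴴ * X i * V = A i := by
  obtain ⟨a, b, ha, hb, hab, rfl⟩ := hC
  refine congrFun (hA.2 (hX.conjTranspose_mul_mul hV) (hY.conjTranspose_mul_mul hV)
    ⟨a, b, ha, hb, hab, ?_⟩) i
  funext j
  simp [← hVC, Matrix.mul_add, Matrix.add_mul]

/-- The direct sum of two observables is an observable. -/
theorem IsObservable.fromBlocks {ι m n : Type*} [Fintype ι] [Fintype m] [DecidableEq m]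
    [Fintype n] [DecidableEq n] {A : ι → Matrix m m ℂ} {B : ι → Matrix n n ℂ}
    (hA : IsObservable A) (hB : IsObservable B) :
    IsObservable (fun i => Matrix.fromBlocks (A i) 0 0 (B i)) := by
  refine ⟨fun i => ?_, ?_⟩
  · let P : Matrix m (m ⊕ n) ℂ := Matrix.fromCols 1 0
    let Q : Matrix n (m ⊕ n) ℂ := Matrix.fromCols 0 1
    have hsum : Matrix.fromBlocks (A i) 0 0 (B i) = Pᴴ * A i * P + Qᴴ * B i * Q := by
      simp [P, Q, Matrix.conjTranspose_fromCols_eq_fromRows_conjTranspose, Matrix.fromRows_mul,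
        Matrix.mul_fromCols]
      ext (j | j) (k | k) <;> simp
    simp only [hsum]
    exact ((hA.1 i).conjTranspose_mul_mul_same _).add ((hB.1 i).conjTranspose_mul_mul_same _)
  · rw [← Matrix.fromBlocks_one, ← hA.2, ← hB.2]
    ext (j | j) (k | k) <;> simp [Matrix.sum_apply]

/-- A direct summand of an extremal observable is extremal. -/
theorem IsExtremalObservable.of_fromBlocks {ι m n : Type*} [Fintype ι] [Fintype m]
    [DecidableEq m] [Fintype n] [DecidableEq n] {A : ι → Matrix m m ℂ} {B : ι → Matrix n n ℂ}
    (hA : IsObservable A) (hB : IsObservable B)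
    (h : IsExtremalObservable (fun i => Matrix.fromBlocks (A i) 0 0 (B i))) :
    IsExtremalObservable A := by
  refine ⟨hA, fun X hX Y hY ⟨a, b, ha, hb, hab, hXY⟩ => ?_⟩
  have hX_eq := h.2 (hX.fromBlocks hB) (hY.fromBlocks hB) ⟨a, b, ha, hb, hab, by
    funext i
    simp [← hXY, Matrix.fromBlocks_smul, Matrix.fromBlocks_add, ← add_smul, hab]⟩
  funext i
  exact (Matrix.fromBlocks_inj.1 (congrFun hX_eq i)).1

/-- The direct sum of an extremal observable with a unitary conjugate of it is extremal. -/
theorem IsExtremalObservable.fromBlocks {ι n : Type*} [Fintype ι] [Fintype n] [DecidableEq n]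
    {A B : ι → Matrix n n ℂ} (hA : IsExtremalObservable A) (hB : IsObservable B)
    {U : Matrix n n ℂ} (hU : U ∈ Matrix.unitaryGroup n ℂ) (hUB : ∀ i, B i = U * A i * Uᴴ) :
    IsExtremalObservable (fun i => Matrix.fromBlocks (A i) 0 0 (B i)) := by
  have hUU : Uᴴ * U = 1 := Matrix.mem_unitaryGroup_iff'.1 hU
  have hUU' : U * Uᴴ = 1 := Matrix.mem_unitaryGroup_iff.1 hU
  have hBU (i : ι) : Uᴴ * (B i * U) = A i := by
    rw [hUB, Matrix.mul_assoc, hUU, Matrix.mul_one, ← Matrix.mul_assoc, hUU, Matrix.one_mul]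
  refine ⟨hA.1.fromBlocks hB, fun X hX Y hY hXY => ?_⟩
  funext i
  have compress (α β : ℂ) (hαβ : star α * α + star β * β = 1) :
      (star α * α) • (X i).toBlocks₁₁ + (star α * β) • ((X i).toBlocks₁₂ * U) +
        (star β * α) • (Uᴴ * (X i).toBlocks₂₁) +
        (star β * β) • (Uᴴ * ((X i).toBlocks₂₂ * U)) = A i := by
    have key := hA.conjTranspose_mul_mul_eq hX hY hXY
      (V := Matrix.fromRows (α • (1 : Matrix n n ℂ)) (β • U)) ?_ ?_ i
    · rw [← key]
      conv_rhs => rw [← Matrix.fromBlocks_toBlocks (X i)]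
      simp only [Matrix.conjTranspose_fromRows_eq_fromCols_conjTranspose,
        Matrix.fromCols_mul_fromBlocks, Matrix.fromCols_mul_fromRows, conjTranspose_smul,
        conjTranspose_one, Matrix.smul_mul, Matrix.mul_smul, Matrix.one_mul, Matrix.mul_one,
        Matrix.add_mul, Matrix.mul_assoc, smul_add, smul_smul]
      module
    · simp only [Matrix.conjTranspose_fromRows_eq_fromCols_conjTranspose,
        Matrix.fromCols_mul_fromRows, conjTranspose_smul, conjTranspose_one, Matrix.smul_mul,
        Matrix.mul_smul, Matrix.one_mul, smul_smul, hUU, ← add_smul]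
      rw [mul_comm α, mul_comm β, hαβ, one_smul]
    · intro j
      simp only [Matrix.conjTranspose_fromRows_eq_fromCols_conjTranspose,
        Matrix.fromCols_mul_fromBlocks, Matrix.fromCols_mul_fromRows, conjTranspose_smul,
        conjTranspose_one, Matrix.smul_mul, Matrix.mul_smul, Matrix.one_mul, Matrix.mul_one,
        Matrix.mul_zero, add_zero, zero_add, Matrix.mul_assoc, smul_smul, hBU,
        ← add_smul]
      rw [mul_comm α, mul_comm β, hαβ, one_smul]
  have h₁₁ : (X i).toBlocks₁₁ = A i := by simpa using compress 1 0 (by simp)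
  have hS : Uᴴ * ((X i).toBlocks₂₂ * U) = A i := by simpa using compress 0 1 (by simp)
  have h₂₂ : (X i).toBlocks₂₂ = B i := by
    rw [hUB, ← hS]
    simp only [Matrix.mul_assoc, hUU', Matrix.mul_one]
    rw [← Matrix.mul_assoc, hUU', Matrix.one_mul]
  have h_real := compress (3 / 5) (4 / 5) (by norm_num)
  have h_imag := compress (3 / 5) (4 / 5 * Complex.I) (by
    simp; linear_combination (-16 / 25) * Complex.I_mul_I)
  rw [h₁₁, hS] at h_real h_imag
  have hQU : (X i).toBlocks₁₂ * U = 0 := by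
    ext j k
    have e₁ := congrFun₂ h_real j k
    have e₂ := congrFun₂ h_imag j k
    simp at e₁ e₂ ⊢
    linear_combination (25 / 24) * e₁ - (25 / 24) * Complex.I * e₂ +
      (((X i).toBlocks₁₂ * U) j k / 2 - 2 / 3 * A i j k * Complex.I -
        (Uᴴ * (X i).toBlocks₂₁) j k / 2) * Complex.I_sq
  have h₁₂ : (X i).toBlocks₁₂ = 0 := by
    rw [← Matrix.mul_one (X i).toBlocks₁₂, ← hUU', ← Matrix.mul_assoc, hQU, Matrix.zero_mul]
  have h₂₁ : (X i).toBlocks₂₁ = 0 := by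
    have hherm := (hX.1 i).isHermitian
    rw [← Matrix.fromBlocks_toBlocks (X i), Matrix.isHermitian_fromBlocks_iff, h₁₂] at hherm
    simpa using hherm.2.1.symm
  rw [← Matrix.fromBlocks_toBlocks (X i), h₁₁, h₁₂, h₂₁, h₂₂]

/-- The direct sum of two unitarily equivalent observables is extremal iff the first one is. -/
theorem stmt_13 {N h : ℕ} (A B : Fin N → Matrix (Fin h) (Fin h) ℂ)
    (hA : IsObservable A) (hB : IsObservable B)
    (U : Matrix (Fin h) (Fin h) ℂ) (hU : U ∈ Matrix.unitaryGroup (Fin h) ℂ)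
    (hUB : ∀ i, B i = U * A i * Uᴴ) :
    IsExtremalObservable (fun i => Matrix.fromBlocks (A i) 0 0 (B i)) ↔
      IsExtremalObservable A := by
  exact ⟨IsExtremalObservable.of_fromBlocks hA hB, fun h => h.fromBlocks hB hU hUB⟩
end

section
/- Let A = (A_1,…,A_N) be an extremal N-valued observable in ℂ^h and let d_i = rank A_i for i = 1,…,N. Then: (a) ∑_{i=1}^N d_i ≥ h; (b) d_i + d_j ≤ h for all i ≠ j; and (c) ∑_{i=1}^N d_i² ≤ h². -/
open Matrix
open scoped ComplexOrder

open scoped MatrixOrder Matrix.Norms.L2Operator in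
/-- Adding a Hermitian matrix to a large enough multiple of the identity gives a positive
semidefinite matrix. -/
lemma Matrix.IsHermitian.exists_forall_ge_posSemidef {n : Type*} [Fintype n] [DecidableEq n]
    {X : Matrix n n ℂ} (hX : X.IsHermitian) :
    ∃ r : ℝ, ∀ c : ℝ, r ≤ c → (c • (1 : Matrix n n ℂ) + X).PosSemidef := by
  refine ⟨‖X‖, fun c hc => ?_⟩
  have h1 : -(algebraMap ℝ (Matrix n n ℂ) ‖X‖) ≤ X :=
    IsSelfAdjoint.neg_algebraMap_norm_le_self (a := X) hX
  have h2 : (X - -(algebraMap ℝ (Matrix n n ℂ) ‖X‖)).PosSemidef := Matrix.le_iff.mp h1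
  have h3 : ((c - ‖X‖) • (1 : Matrix n n ℂ)).PosSemidef :=
    Matrix.PosSemidef.one.smul (sub_nonneg.mpr hc)
  convert h2.add h3 using 1
  rw [Algebra.algebraMap_eq_smul_one, sub_smul]
  abel

/-- A positive semidefinite matrix factors as `V * Vᴴ`, where `V` has as many columns as the rank
of the matrix and admits a left inverse. -/
lemma Matrix.PosSemidef.exists_rank_factorization {n : Type*} [Fintype n] [DecidableEq n]
    {A : Matrix n n ℂ} (hA : A.PosSemidef) :
    ∃ (V : Matrix n (Fin A.rank) ℂ) (W : Matrix (Fin A.rank) n ℂ), W * V = 1 ∧ V * Vᴴ = A := by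
  have hH := hA.isHermitian
  let ev := hH.eigenvalues
  let U : Matrix n n ℂ := hH.eigenvectorUnitary
  have hU : Uᴴ * U = 1 := Unitary.coe_star_mul_self hH.eigenvectorUnitary
  have hspec : A = U * diagonal (fun k => (ev k : ℂ)) * Uᴴ := hH.spectral_theorem
  let e : Fin A.rank ≃ {k // ev k ≠ 0} :=
    Fintype.equivOfCardEq (by rw [Fintype.card_fin]; exact hH.rank_eq_card_non_zero_eigs)
  have hpos : ∀ j, 0 < ev (e j).1 := fun j =>
    lt_of_le_of_ne (hA.eigenvalues_nonneg _) (e j).2.symm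
  have hs : ∀ k, ((√(ev k) : ℝ) : ℂ) * (√(ev k) : ℝ) = ev k := fun k => by
    rw [← Complex.ofReal_mul, Real.mul_self_sqrt (hA.eigenvalues_nonneg k)]
  refine ⟨Matrix.of fun k j => U k (e j).1 * (√(ev (e j).1) : ℝ),
    Matrix.of fun j k => ((√(ev (e j).1) : ℝ) : ℂ)⁻¹ * star (U k (e j).1), ?_, ?_⟩
  · ext j l
    have hne : ((√(ev (e l).1) : ℝ) : ℂ) ≠ 0 := by
      exact_mod_cast (Real.sqrt_pos.mpr (hpos l)).ne'
    have h1 := congrFun (congrFun hU (e j).1) (e l).1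
    simp only [Matrix.mul_apply, Matrix.conjTranspose_apply] at h1
    simp only [Matrix.mul_apply, Matrix.of_apply]
    calc _ = ((√(ev (e j).1) : ℝ) : ℂ)⁻¹ * (∑ k, star (U k (e j).1) * U k (e l).1)
            * (√(ev (e l).1) : ℝ) := by
          rw [Finset.mul_sum, Finset.sum_mul]
          exact Finset.sum_congr rfl fun k _ => by ring
      _ = _ := by
          rw [h1]
          by_cases hjl : j = l
          · subst hjl; simp [hne]
          · have : (e j).1 ≠ (e l).1 := fun h => hjl (e.injective (Subtype.ext h))
            simp [hjl, this]
  · ext k l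
    conv_rhs => rw [hspec, Matrix.mul_apply]
    simp only [Matrix.mul_diagonal]
    simp only [Matrix.mul_apply, Matrix.of_apply, Matrix.conjTranspose_apply]
    rw [e.sum_comp (fun m : {k // ev k ≠ 0} => U k m.1 * ((√(ev m.1) : ℝ) : ℂ) *
        star (U l m.1 * ((√(ev m.1) : ℝ) : ℂ))),
      ← Finset.sum_subtype (Finset.univ.filter fun m => ev m ≠ 0) (by simp)
        (fun m => U k m * ((√(ev m) : ℝ) : ℂ) * star (U l m * ((√(ev m) : ℝ) : ℂ)))]
    refine Finset.sum_subset_zero_on_sdiff (Finset.subset_univ _) (fun m hm => ?_) fun m _ => ?_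
    · have hm0 : ev m = 0 := by simpa using hm
      simp [hm0]
    · rw [← hs m, star_mul, Complex.star_def, Complex.conj_ofReal]
      ring

/-- The components of an extremal observable admit no nontrivial Hermitian relation. -/
lemma IsExtremalObservable.eq_zero_of_isHermitian {ι n : Type*} [Fintype ι] [Fintype n]
    [DecidableEq n] {A : ι → Matrix n n ℂ} (hA : IsExtremalObservable A)
    {σ : ι → Type*} [∀ i, Fintype (σ i)] [∀ i, DecidableEq (σ i)]
    {V : ∀ i, Matrix n (σ i) ℂ} {W : ∀ i, Matrix (σ i) n ℂ} (hWV : ∀ i, W i * V i = 1)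
    (hVA : ∀ i, V i * (V i)ᴴ = A i) {X : ∀ i, Matrix (σ i) (σ i) ℂ}
    (hX : ∀ i, (X i).IsHermitian) (hsum : ∑ i, V i * X i * (V i)ᴴ = 0) (i : ι) : X i = 0 := by
  choose r hr using fun i => (hX i).exists_forall_ge_posSemidef
  choose s hs using fun i => (hX i).neg.exists_forall_ge_posSemidef
  obtain ⟨c, hc0, hcr, hcs⟩ : ∃ c : ℝ, 0 < c ∧ (∀ i, r i ≤ c) ∧ ∀ i, s i ≤ c := by
    have hle : ∀ (f : ι → ℝ) i, f i ≤ ∑ j, |f j| := fun f i =>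
      (le_abs_self _).trans
        (Finset.single_le_sum (f := fun j => |f j|) (fun j _ => abs_nonneg _) (Finset.mem_univ i))
    have hnn : ∀ f : ι → ℝ, 0 ≤ ∑ j, |f j| := fun f => Finset.sum_nonneg fun j _ => abs_nonneg _
    exact ⟨∑ j, |r j| + ∑ j, |s j| + 1, by linarith [hnn r, hnn s],
      fun i => by linarith [hle r i, hnn s], fun i => by linarith [hle s i, hnn r]⟩
  have hobs : ∀ Y : ∀ i, Matrix (σ i) (σ i) ℂ,
      (∀ i, (c • (1 : Matrix (σ i) (σ i) ℂ) + Y i).PosSemidef) →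
      ∑ i, V i * Y i * (V i)ᴴ = 0 →
      IsObservable fun i => A i + c⁻¹ • (V i * Y i * (V i)ᴴ) := by
    intro Y hY hY0
    refine ⟨fun i => ?_, ?_⟩
    · have h := ((hY i).mul_mul_conjTranspose_same (V i)).smul (inv_nonneg.mpr hc0.le)
      convert h using 1
      rw [Matrix.mul_add, Matrix.add_mul, smul_add, Matrix.mul_smul, Matrix.smul_mul, smul_smul,
        inv_mul_cancel₀ hc0.ne', one_smul, Matrix.mul_one, hVA]
    · rw [Finset.sum_add_distrib, ← Finset.smul_sum, hY0, smul_zero, add_zero]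
      exact hA.1.2
  have h1 := hobs X (fun i => hr i c (hcr i)) hsum
  have h2 := hobs (fun i => -X i) (fun i => hs i c (hcs i)) (by simp [hsum])
  have hmem : A ∈ openSegment ℝ (fun i => A i + c⁻¹ • (V i * X i * (V i)ᴴ))
      (fun i => A i + c⁻¹ • (V i * -X i * (V i)ᴴ)) := by
    refine ⟨1 / 2, 1 / 2, by norm_num, by norm_num, by norm_num, ?_⟩
    funext i
    simp only [Pi.add_apply, Pi.smul_apply, Matrix.mul_neg, Matrix.neg_mul]
    module
  have h3 := congrFun (hA.2 h1 h2 hmem) i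
  have h4 : V i * X i * (V i)ᴴ = 0 := by
    simpa [hc0.ne'] using h3
  have h5 : (V i)ᴴ * (W i)ᴴ = 1 := by
    rw [← Matrix.conjTranspose_mul, hWV, Matrix.conjTranspose_one]
  calc X i = (W i * V i) * X i * ((V i)ᴴ * (W i)ᴴ) := by rw [hWV, h5]; simp
    _ = W i * (V i * X i * (V i)ᴴ) * (W i)ᴴ := by simp only [Matrix.mul_assoc]
    _ = 0 := by rw [h4]; simp

/-- The components of an extremal observable admit no nontrivial relation. -/
lemma IsExtremalObservable.eq_zero {ι n : Type*} [Fintype ι] [Fintype n]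
    [DecidableEq n] {A : ι → Matrix n n ℂ} (hA : IsExtremalObservable A)
    {σ : ι → Type*} [∀ i, Fintype (σ i)] [∀ i, DecidableEq (σ i)]
    {V : ∀ i, Matrix n (σ i) ℂ} {W : ∀ i, Matrix (σ i) n ℂ} (hWV : ∀ i, W i * V i = 1)
    (hVA : ∀ i, V i * (V i)ᴴ = A i) {X : ∀ i, Matrix (σ i) (σ i) ℂ}
    (hsum : ∑ i, V i * X i * (V i)ᴴ = 0) (i : ι) : X i = 0 := by
  have hsum' : ∑ i, V i * (X i)ᴴ * (V i)ᴴ = 0 := by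
    have := congrArg Matrix.conjTranspose hsum
    simpa [Matrix.conjTranspose_sum, Matrix.conjTranspose_mul, Matrix.mul_assoc] using this
  have h1 : X i + (X i)ᴴ = 0 := hA.eq_zero_of_isHermitian hWV hVA (X := fun i => X i + (X i)ᴴ)
    (fun i => Matrix.isHermitian_add_transpose_self (X i))
    (by simp only [Matrix.mul_add, Matrix.add_mul, Finset.sum_add_distrib, hsum, hsum', add_zero]) i
  have h2 : Complex.I • (X i - (X i)ᴴ) = 0 :=
    hA.eq_zero_of_isHermitian hWV hVA (X := fun i => Complex.I • (X i - (X i)ᴴ))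
    (fun i => by
      rw [Matrix.IsHermitian, Matrix.conjTranspose_smul, Matrix.conjTranspose_sub,
        Matrix.conjTranspose_conjTranspose, Complex.star_def, Complex.conj_I, neg_smul, ← smul_neg,
        neg_sub])
    (by simp only [Matrix.mul_smul, Matrix.smul_mul, Matrix.mul_sub, Matrix.sub_mul,
          ← Finset.smul_sum, Finset.sum_sub_distrib, hsum, hsum', sub_zero, smul_zero]) i
  have h3 : X i - (X i)ᴴ = 0 := (smul_eq_zero.mp h2).resolve_left Complex.I_ne_zero
  have h4 : (2 : ℂ) • X i = 0 := by
    rw [two_smul]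
    calc X i + X i = (X i + (X i)ᴴ) + (X i - (X i)ᴴ) := by abel
      _ = 0 := by rw [h1, h3, add_zero]
  exact (smul_eq_zero.mp h4).resolve_left two_ne_zero

/-- The rank of a sum of two matrices is at most the sum of their ranks. -/
lemma Matrix.rank_add_le {m n K : Type*} [Fintype m] [Fintype n] [Field K]
    (A B : Matrix m n K) : (A + B).rank ≤ A.rank + B.rank := by
  have hle : LinearMap.range (A + B).mulVecLin ≤
      LinearMap.range A.mulVecLin ⊔ LinearMap.range B.mulVecLin := by
    rw [Matrix.mulVecLin_add]
    rintro _ ⟨x, rfl⟩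
    exact Submodule.add_mem_sup ⟨x, rfl⟩ ⟨x, rfl⟩
  exact (Submodule.finrank_mono hle).trans (Submodule.finrank_add_le_finrank_add_finrank _ _)

/-- The rank of a finite sum of matrices is at most the sum of their ranks. -/
lemma Matrix.rank_sum_le {ι m n K : Type*} [Fintype m] [Fintype n] [Field K]
    (s : Finset ι) (A : ι → Matrix m n K) : (∑ i ∈ s, A i).rank ≤ ∑ i ∈ s, (A i).rank := by
  classical
  induction s using Finset.induction_on with
  | empty => simp
  | insert a s ha ih =>
    rw [Finset.sum_insert ha, Finset.sum_insert ha]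
    exact (Matrix.rank_add_le _ _).trans (Nat.add_le_add_left ih _)

/-- Constraints on the ranks `d i = rank (A i)` of the components of an extremal observable
in `ℂ^h`: (a) `∑ d i ≥ h`, (b) `d i + d j ≤ h` for `i ≠ j`, (c) `∑ (d i)² ≤ h²`. -/
theorem stmt_19 {N h : ℕ} (A : Fin N → Matrix (Fin h) (Fin h) ℂ)
    (hA : IsObservable A) (hAex : IsExtremalObservable A) :
    (h ≤ ∑ i, (A i).rank) ∧
    (∀ i j, i ≠ j → (A i).rank + (A j).rank ≤ h) ∧
    (∑ i, (A i).rank ^ 2 ≤ h ^ 2) := by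
  choose V W hWV hVA using fun i => (hA.1 i).exists_rank_factorization
  refine ⟨?_, fun i j hij => ?_, ?_⟩
  · have h1 := Matrix.rank_sum_le Finset.univ A
    rwa [hA.2, Matrix.rank_one, Fintype.card_fin] at h1
  · by_contra! hlt
    let f : ((Fin (A i).rank → ℂ) × (Fin (A j).rank → ℂ)) →ₗ[ℂ] (Fin h → ℂ) :=
      (V i).mulVecLin.coprod (V j).mulVecLin
    obtain ⟨⟨x, y⟩, hxy, hne⟩ : ∃ p, f p = 0 ∧ p ≠ 0 := by
      have := LinearMap.ker_ne_bot_of_finrank_lt (f := f) (by simpa using hlt)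
      obtain ⟨p, hp, hp0⟩ := (Submodule.ne_bot_iff _).mp this
      exact ⟨p, hp, hp0⟩
    have hVxy : V i *ᵥ x = -(V j *ᵥ y) := by
      simpa [f, add_eq_zero_iff_eq_neg] using hxy
    let X : ∀ k, Matrix (Fin (A k).rank) (Fin (A k).rank) ℂ :=
      Function.update (Function.update 0 i (vecMulVec x (star x))) j (-vecMulVec y (star y))
    have hXi : X i = vecMulVec x (star x) := by simp [X, hij]
    have hXj : X j = -vecMulVec y (star y) := by simp [X]
    have hXk : ∀ k, k ≠ i ∧ k ≠ j → V k * X k * (V k)ᴴ = 0 := fun k hk => by simp [X, hk]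
    have hconj : ∀ k (z : Fin (A k).rank → ℂ), V k * vecMulVec z (star z) * (V k)ᴴ =
        vecMulVec (V k *ᵥ z) (star (V k *ᵥ z)) := fun k z => by
      rw [Matrix.mul_vecMulVec, Matrix.vecMulVec_mul, Matrix.star_mulVec]
    have hsum : ∑ k, V k * X k * (V k)ᴴ = 0 := by
      rw [Fintype.sum_eq_add i j hij hXk, hXi, hXj, Matrix.mul_neg, Matrix.neg_mul, hconj, hconj,
        hVxy]
      simp
    have hXi0 := hAex.eq_zero hWV hVA hsum i
    have hXj0 := hAex.eq_zero hWV hVA hsum j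
    rw [hXi] at hXi0
    rw [hXj, neg_eq_zero] at hXj0
    exact hne (Prod.ext (by simpa using hXi0) (by simpa using hXj0))
  · let f : (∀ i, Matrix (Fin (A i).rank) (Fin (A i).rank) ℂ) →ₗ[ℂ] Matrix (Fin h) (Fin h) ℂ :=
      { toFun := fun X => ∑ i, V i * X i * (V i)ᴴ
        map_add' := fun X Y => by
          simp [Matrix.mul_add, Matrix.add_mul, Finset.sum_add_distrib]
        map_smul' := fun a X => by simp [Finset.smul_sum] }
    have hf : Function.Injective f := (injective_iff_map_eq_zero f).mpr fun X hX =>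
      funext fun i => hAex.eq_zero hWV hVA hX i
    have hdim := LinearMap.finrank_le_finrank_of_injective hf
    simpa [Module.finrank_pi_fintype, Module.finrank_matrix, sq] using hdim
end
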